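/- Let p be a prime, n ≥ 1, fix i₀ ∈ Fin n, let D = {z ∈ ℚ_p^n : |z_k|_p ≤ 1 for all k, and |z_{i₀}|_p = 1}, and let T : ℚ_p^n → ℚ_p^n be defined on D by T(z)_{i₀} = (z_{i₀})⁻¹ and T(z)_k = z_k · (z_{i₀})⁻¹ for k ≠ i₀. Then for every a ∈ D and every real r with 0 < r ≤ 1/p, the closed ball closedBall(a, r) (for the sup norm) is contained in D, and T(closedBall(a, r)) = closedBall(T(a), r). In other words, the standard atlas of ℙⁿ(ℚ_p) is equalising with equalising number 1: its transition maps take every ball of radius ≤ p^{-1} contained in their domain onto a ball of equal radius. -/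

import Mathlib

open Set

/-- The image `D` of the overlap of two standard charts of `ℙⁿ(ℚ_p)`:
integral points whose `i₀`-th coordinate is a unit. -/
def projOverlap (p : ℕ) [Fact p.Prime] (n : ℕ) (i₀ : Fin n) : Set (Fin n → ℚ_[p]) :=
  {z | (∀ k, ‖z k‖ ≤ 1) ∧ ‖z i₀‖ = 1}

/-- The transition map of the standard atlas of `ℙⁿ(ℚ_p)` between the charts indexed by
`i₀` and the chart at infinity: `T(z)_{i₀} = z_{i₀}⁻¹`, `T(z)_k = z_k ⋅ z_{i₀}⁻¹`. -/
noncomputable def projTransition (p : ℕ) [Fact p.Prime] (n : ℕ) (i₀ : Fin n) :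
    (Fin n → ℚ_[p]) → (Fin n → ℚ_[p]) :=
  fun z k => if k = i₀ then (z i₀)⁻¹ else z k * (z i₀)⁻¹

/-- A closed ball of radius `r < 1` centred in the overlap is contained in the overlap. -/
theorem closedBall_subset_projOverlap {p : ℕ} [Fact p.Prime] {n : ℕ} {i₀ : Fin n}
    {a : Fin n → ℚ_[p]} (ha : a ∈ projOverlap p n i₀) {r : ℝ} (hr0 : 0 ≤ r) (hr : r < 1) :
    Metric.closedBall a r ⊆ projOverlap p n i₀ := by
  intro z hz
  have hd : ∀ k, ‖z k - a k‖ ≤ r := by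
    simpa [dist_eq_norm] using (dist_pi_le_iff hr0).1 (Metric.mem_closedBall.1 hz)
  refine ⟨fun k => ?_, ?_⟩
  · have h := Padic.nonarchimedean (z k - a k) (a k)
    rw [sub_add_cancel] at h
    exact h.trans (max_le ((hd k).trans hr.le) (ha.1 k))
  · have hlt : ‖z i₀ - a i₀‖ < ‖a i₀‖ := by
      rw [ha.2]
      exact (hd i₀).trans_lt hr
    have h := Padic.add_eq_max_of_ne hlt.ne
    rwa [sub_add_cancel, max_eq_right hlt.le, ha.2] at h

/-- The transition map preserves the overlap. -/
theorem projTransition_mem_projOverlap {p : ℕ} [Fact p.Prime] {n : ℕ} {i₀ : Fin n}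
    {z : Fin n → ℚ_[p]} (hz : z ∈ projOverlap p n i₀) :
    projTransition p n i₀ z ∈ projOverlap p n i₀ := by
  refine ⟨fun k => ?_, by simp [projTransition, hz.2]⟩
  by_cases hk : k = i₀
  · simp [projTransition, hk, hz.2]
  · simpa [projTransition, hk, hz.2] using hz.1 k

/-- The transition map is an involution on the overlap. -/
theorem projTransition_projTransition {p : ℕ} [Fact p.Prime] {n : ℕ} {i₀ : Fin n}
    {z : Fin n → ℚ_[p]} (hz : z ∈ projOverlap p n i₀) :
    projTransition p n i₀ (projTransition p n i₀ z) = z := by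
  have h0 : z i₀ ≠ 0 := norm_ne_zero_iff.1 (by simp [hz.2])
  ext k
  by_cases hk : k = i₀
  · simp [projTransition, hk]
  · simp [projTransition, hk, h0]

/-- The transition map does not increase distances on the overlap. -/
theorem dist_projTransition_le {p : ℕ} [Fact p.Prime] {n : ℕ} {i₀ : Fin n}
    {z w : Fin n → ℚ_[p]} (hz : z ∈ projOverlap p n i₀) (hw : w ∈ projOverlap p n i₀) :
    dist (projTransition p n i₀ z) (projTransition p n i₀ w) ≤ dist z w := by
  have hz0 : z i₀ ≠ 0 := norm_ne_zero_iff.1 (by simp [hz.2])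
  have hw0 : w i₀ ≠ 0 := norm_ne_zero_iff.1 (by simp [hw.2])
  have hd : ∀ k, ‖z k - w k‖ ≤ dist z w := fun k => by
    simpa [dist_eq_norm] using dist_le_pi_dist z w k
  refine (dist_pi_le_iff dist_nonneg).2 fun k => ?_
  rw [dist_eq_norm]
  by_cases hk : k = i₀
  · have h : (z i₀)⁻¹ - (w i₀)⁻¹ = -(z i₀ - w i₀) * ((z i₀)⁻¹ * (w i₀)⁻¹) := by
      field_simp
      ring
    simp only [projTransition, hk, if_true]
    rw [h, norm_mul, norm_mul, norm_inv, norm_inv, hz.2, hw.2, norm_neg]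
    simpa using hd i₀
  · have h : z k * (z i₀)⁻¹ - w k * (w i₀)⁻¹ =
        (z i₀ * (z k - w k) + -(z k * (z i₀ - w i₀))) * ((z i₀)⁻¹ * (w i₀)⁻¹) := by
      field_simp
      ring
    simp only [projTransition, hk, if_false]
    rw [h, norm_mul, norm_mul, norm_inv, norm_inv, hz.2, hw.2, inv_one, mul_one, mul_one]
    refine (Padic.nonarchimedean _ _).trans (max_le ?_ ?_)
    · rw [norm_mul, hz.2, one_mul]
      exact hd k
    · rw [norm_neg, norm_mul]
      exact (mul_le_of_le_one_left (norm_nonneg _) (hz.1 k)).trans (hd i₀)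

/-- The standard atlas of `ℙⁿ(ℚ_p)` is equalising with equalising
number `1`: for every `a ∈ D` and every radius `0 < r ≤ 1/p`, the closed ball
`closedBall(a, r)` (sup norm) is contained in `D` and the transition map `T` takes it
onto the closed ball `closedBall(T(a), r)` of equal radius. -/
theorem projTransition_equalising (p : ℕ) [Fact p.Prime] (n : ℕ) (hn : 1 ≤ n)
    (i₀ : Fin n) :
    ∀ a ∈ projOverlap p n i₀, ∀ r : ℝ, 0 < r → r ≤ 1 / p →
      Metric.closedBall a r ⊆ projOverlap p n i₀ ∧
      projTransition p n i₀ '' Metric.closedBall a r =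
        Metric.closedBall (projTransition p n i₀ a) r := by
  intro a ha r hr0 hr
  have hp : (1 : ℝ) < p := by exact_mod_cast (Fact.out : p.Prime).one_lt
  have hr1 : r < 1 := hr.trans_lt ((div_lt_one (by linarith)).2 hp)
  have hsub := closedBall_subset_projOverlap ha hr0.le hr1
  have hTa := projTransition_mem_projOverlap ha
  refine ⟨hsub, Subset.antisymm ?_ fun w hw => ?_⟩
  · rintro _ ⟨z, hz, rfl⟩
    exact (dist_projTransition_le (hsub hz) ha).trans hz
  · have hwD := closedBall_subset_projOverlap hTa hr0.le hr1 hw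
    refine ⟨projTransition p n i₀ w, ?_, projTransition_projTransition hwD⟩
    have h := (dist_projTransition_le hwD hTa).trans hw
    rwa [projTransition_projTransition ha] at h
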